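/- For every irrational number α there exists a dense G_δ subset R(α) of the space 𝒫 such that for every 𝔣 ∈ R(α) and every x ∈ 𝕋, the random walk (ξ_n) in the environment (𝔭, α, x) satisfies ℙ_x(max_{j≤n} ξ_j = ξ_n) → 0 and ℙ_x(min_{j≤n} ξ_j = ξ_n) → 0 as n → ∞. -/

import Mathlib

open MeasureTheory Filter Finset

noncomputable section

attribute [local instance] Classical.propDecidable

/-- The point `x + j·α` on the circle `𝕋 = ℝ/ℤ`. -/
def pt (α : ℝ) (x : UnitAddCircle) (j : ℤ) : UnitAddCircle :=
  x + (((j : ℝ) * α : ℝ) : UnitAddCircle)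

/-- One-step transition probability of the random walk on `ℤ` in the quasi-periodic
environment `(𝔭, α, x)`: from `j` it jumps to `j+1` with probability `𝔭(x+jα)` and to
`j-1` with probability `𝔮(x+jα) = 1-𝔭(x+jα)`. -/
def stepProb (𝔭 : UnitAddCircle → ℝ) (α : ℝ) (x : UnitAddCircle) (j j' : ℤ) : ℝ :=
  if j' = j + 1 then 𝔭 (pt α x j) else if j' = j - 1 then 1 - 𝔭 (pt α x j) else 0

/-- `ξ` is (a version of) the random walk on `ℤ` in the quasi-periodic environment
`(𝔭, α, x)` started at `start`, defined on the probability space `(Ω, ℙ)`; this is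
expressed through its finite-dimensional distributions. -/
def IsQPWalk (𝔭 : UnitAddCircle → ℝ) (α : ℝ) (x : UnitAddCircle) (start : ℤ)
    {Ω : Type} [MeasurableSpace Ω] (ℙ : Measure Ω) (ξ : ℕ → Ω → ℤ) : Prop :=
  IsProbabilityMeasure ℙ ∧ (∀ n, Measurable (ξ n)) ∧
  ∀ (n : ℕ) (k : ℕ → ℤ),
    ℙ {ω | ∀ i ≤ n, ξ i ω = k i} =
      ENNReal.ofReal ((if k 0 = start then (1 : ℝ) else 0) *
        ∏ i ∈ Finset.range n, stepProb 𝔭 α x (k i) (k (i + 1)))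

/-- `𝔣` is continuous, of bounded variation, with `∫_𝕋 𝔣(z) dz = 0`. -/
def ZeroMeanBV (𝔣 : UnitAddCircle → ℝ) : Prop :=
  Continuous 𝔣 ∧ BoundedVariationOn (fun t : ℝ => 𝔣 (t : UnitAddCircle)) (Set.Icc 0 1) ∧
    ∫ z : UnitAddCircle, 𝔣 z = 0

/-- The function `𝔭 = e^𝔣/(1+e^𝔣)` associated to `𝔣`. -/
def pOf (𝔣 : UnitAddCircle → ℝ) : UnitAddCircle → ℝ :=
  fun z => Real.exp (𝔣 z) / (1 + Real.exp (𝔣 z))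

/-- `f : ℝ → ℝ` is absolutely continuous on `[0,1]`. -/
def AbsolutelyContinuousOn01 (f : ℝ → ℝ) : Prop :=
  ∀ ε > 0, ∃ δ > 0, ∀ (n : ℕ) (a b : Fin n → ℝ),
    (∀ i, a i ∈ Set.Icc (0:ℝ) 1 ∧ b i ∈ Set.Icc (0:ℝ) 1 ∧ a i ≤ b i) →
    (Pairwise fun i j => Disjoint (Set.Ioo (a i) (b i)) (Set.Ioo (a j) (b j))) →
    ∑ i, (b i - a i) < δ → ∑ i, |f (b i) - f (a i)| < ε

/-- Membership in the space `𝒫` of absolutely continuous functions on the circle with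
`∫_𝕋 𝔣(z) dz = 0`. -/
def memP (𝔣 : UnitAddCircle → ℝ) : Prop :=
  Continuous 𝔣 ∧ AbsolutelyContinuousOn01 (fun t : ℝ => 𝔣 (t : UnitAddCircle)) ∧
    ∫ z : UnitAddCircle, 𝔣 z = 0

/-- The norm `‖f‖_BV = ‖f‖_∞ + var(f)` on functions on the circle. -/
def bvNorm (f : UnitAddCircle → ℝ) : ℝ :=
  (⨆ x : UnitAddCircle, |f x|) +
    (eVariationOn (fun t : ℝ => f (t : UnitAddCircle)) (Set.Icc 0 1)).toReal

/-- Condition (1.6): `ℙ_x(max_{j≤n} ξ_j = ξ_n) → 0` and `ℙ_x(min_{j≤n} ξ_j = ξ_n) → 0`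
as `n → ∞`. -/
def MaxMinCond {Ω : Type} [MeasurableSpace Ω] (ℙ : Measure Ω) (ξ : ℕ → Ω → ℤ) : Prop :=
  Tendsto (fun n => (ℙ {ω | ∀ j ≤ n, ξ j ω ≤ ξ n ω}).toReal) atTop (nhds 0) ∧
    Tendsto (fun n => (ℙ {ω | ∀ j ≤ n, ξ n ω ≤ ξ j ω}).toReal) atTop (nhds 0)

/-- Probability that the drawdown from the running maximum, started at `d`, vanishes after
`n` steps. -/
def BB (p : UnitAddCircle → ℝ) (a : UnitAddCircle) : ℕ → UnitAddCircle → ℕ → ℝ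
  | 0, _, d => if d = 0 then 1 else 0
  | n + 1, x, d => p x * BB p a n (x + a) (d - 1) + (1 - p x) * BB p a n (x - a) (d + 1)

section BBlemmas

variable {p : UnitAddCircle → ℝ} {a : UnitAddCircle}

theorem conv_le {t u v c : ℝ} (h0 : 0 ≤ t) (h1 : t ≤ 1) (hu : u ≤ c) (hv : v ≤ c) :
    t * u + (1 - t) * v ≤ c := by
  nlinarith [mul_nonneg h0 (sub_nonneg.2 hu), mul_nonneg (sub_nonneg.2 h1) (sub_nonneg.2 hv)]

theorem BB_nonneg (hp : ∀ x, 0 ≤ p x ∧ p x ≤ 1) (n : ℕ) (x : UnitAddCircle) (d : ℕ) :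
    0 ≤ BB p a n x d := by
  induction n generalizing x d with
  | zero => simp only [BB]; split_ifs <;> norm_num
  | succ n ih =>
    have h := hp x
    have := ih (x + a) (d - 1)
    have := ih (x - a) (d + 1)
    simp only [BB]
    have : 0 ≤ 1 - p x := by linarith
    have := h.1
    positivity

theorem BB_le_one (hp : ∀ x, 0 ≤ p x ∧ p x ≤ 1) (n : ℕ) (x : UnitAddCircle) (d : ℕ) :
    BB p a n x d ≤ 1 := by
  induction n generalizing x d with
  | zero => simp only [BB]; split_ifs <;> norm_num
  | succ n ih => exact conv_le (hp x).1 (hp x).2 (ih _ _) (ih _ _)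

theorem BB_anti (hp : ∀ x, 0 ≤ p x ∧ p x ≤ 1) (n : ℕ) (x : UnitAddCircle) :
    Antitone (BB p a n x) := by
  induction n generalizing x with
  | zero =>
    intro d e h
    simp only [BB]
    split_ifs <;> first | omega | norm_num
  | succ n ih =>
    intro d e h
    simp only [BB]
    have h1 : BB p a n (x + a) (e - 1) ≤ BB p a n (x + a) (d - 1) := ih _ (by omega)
    have h2 : BB p a n (x - a) (e + 1) ≤ BB p a n (x - a) (d + 1) := ih _ (by omega)
    have := hp x
    have := mul_le_mul_of_nonneg_left h1 this.1
    have := mul_le_mul_of_nonneg_left h2 (sub_nonneg.2 (hp x).2)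
    linarith

theorem BB_mono_sup (hp : ∀ x, 0 ≤ p x ∧ p x ≤ 1) {n : ℕ} {c : ℝ}
    (h : ∀ x, BB p a n x 0 ≤ c) (m : ℕ) (x : UnitAddCircle) (d : ℕ) :
    BB p a (n + m) x d ≤ c := by
  induction m generalizing x d with
  | zero => exact (BB_anti hp n x (Nat.zero_le d)).trans (h x)
  | succ m ih => exact conv_le (hp x).1 (hp x).2 (ih _ _) (ih _ _)

theorem BB_sum (hp : ∀ x, 0 ≤ p x ∧ p x ≤ 1) {M : ℕ} {K : ℝ}
    (h : ∀ x, ∑ i ∈ range M, BB p a i x 0 ≤ K) (n : ℕ) (x : UnitAddCircle) (d : ℕ) :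
    ∑ i ∈ range M, BB p a (n + i) x d ≤ K := by
  induction n generalizing x d with
  | zero =>
    refine le_trans (Finset.sum_le_sum fun i _ => ?_) (h x)
    rw [zero_add]
    exact BB_anti hp i x (Nat.zero_le d)
  | succ n ih =>
    have : ∑ i ∈ range M, BB p a (n + 1 + i) x d =
        p x * (∑ i ∈ range M, BB p a (n + i) (x + a) (d - 1)) +
        (1 - p x) * ∑ i ∈ range M, BB p a (n + i) (x - a) (d + 1) := by
      rw [Finset.mul_sum, Finset.mul_sum, ← Finset.sum_add_distrib]
      refine Finset.sum_congr rfl fun i _ => ?_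
      rw [add_right_comm]
      rfl
    rw [this]
    exact conv_le (hp x).1 (hp x).2 (ih _ _) (ih _ _)

theorem BB_step (hp : ∀ x, 0 ≤ p x ∧ p x ≤ 1) (n : ℕ) (x : UnitAddCircle) :
    BB p a (n + 1) x 0 ≤ p x * BB p a n (x + a) 0 + (1 - p x) * BB p a n (x - a) 0 := by
  simp only [BB]
  have h2 : BB p a n (x - a) (0 + 1) ≤ BB p a n (x - a) 0 := BB_anti hp n _ (by omega)
  have := mul_le_mul_of_nonneg_left h2 (sub_nonneg.2 (hp x).2)
  simpa using this

theorem even_sum_le (h : ℕ → ℝ) (hh : ∀ i, 0 ≤ h i) (M : ℕ) :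
    ∑ i ∈ range M, h (2 * i) ≤ ∑ i ∈ range (2 * M), h i := by
  induction M with
  | zero => simp
  | succ M ih =>
    rw [Finset.sum_range_succ, show 2 * (M + 1) = 2 * M + 1 + 1 by ring, Finset.sum_range_succ,
      Finset.sum_range_succ]
    linarith [hh (2 * M + 1)]

/-- From averaged smallness to smallness at one time. -/
theorem BB_small (hp : ∀ x, 0 ≤ p x ∧ p x ≤ 1) {δ : ℝ} (hδ : 0 < δ)
    (hpδ : ∀ x, δ ≤ p x * (1 - p (x + a)))
    (havg : ∀ ε > 0, ∃ M > 0, ∀ x, ∑ i ∈ range (2 * M), BB p a i x 0 ≤ ε * M)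
    {ε : ℝ} (hε : 0 < ε) : ∃ n, ∀ x, BB p a n x 0 ≤ ε := by
  by_contra! hcon
  set s : Set ℝ := {c | ∃ n, ∀ x, BB p a n x 0 ≤ c} with hs
  have hsne : s.Nonempty := ⟨1, 0, fun x => BB_le_one hp 0 x 0⟩
  have hlow : ∀ c ∈ s, ε ≤ c := by
    rintro c ⟨n, hn⟩
    obtain ⟨x, hx⟩ := hcon n
    exact hx.le.trans (hn x)
  have hbdd : BddBelow s := ⟨ε, hlow⟩
  set A := sInf s with hA
  have hAε : ε ≤ A := le_csInf hsne hlow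
  have hApos : 0 < A := hε.trans_le hAε
  obtain ⟨M, hM, hsum⟩ := havg (A / 4) (by positivity)
  have hδ1 : δ ≤ 1 := by
    have h1 := hp 0
    have h2 := hp (0 + a)
    have := hpδ 0
    nlinarith
  have hδM : 0 < δ ^ M := by positivity
  set η := A / 4 * δ ^ M with hη
  have hηpos : 0 < η := by positivity
  obtain ⟨c, ⟨n0, hn0⟩, hc⟩ := exists_lt_of_csInf_lt hsne (show sInf s < A + η by linarith)
  have hcA : A ≤ c := csInf_le hbdd ⟨n0, hn0⟩
  have hnot : ∃ x, A - η < BB p a (n0 + 2 * M) x 0 := by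
    by_contra! h
    have := csInf_le hbdd (show A - η ∈ s from ⟨_, h⟩)
    linarith
  obtain ⟨x, hx⟩ := hnot
  have hle : ∀ m y, BB p a (n0 + m) y 0 ≤ c := fun m y => BB_mono_sup hp hn0 m y 0
  have key : ∀ m y, δ * (c - BB p a (n0 + m) y 0) ≤ c - BB p a (n0 + m + 2) y 0 := by
    intro m y
    have h1 := BB_step (a := a) hp (n0 + m + 1) y
    have h2 := BB_step (a := a) hp (n0 + m) (y + a)
    rw [add_sub_cancel_right] at h2
    have h3 := hle m (y + a + a)
    have h4 : BB p a (n0 + m + 1) (y - a) 0 ≤ c := hle (m + 1) (y - a)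
    have h5 := hle m y
    have hpy := hp y
    have hpy' := hp (y + a)
    have h6 : BB p a (n0 + m + 1) (y + a) 0 ≤
        p (y + a) * c + (1 - p (y + a)) * BB p a (n0 + m) y 0 := by
      have := mul_le_mul_of_nonneg_left h3 hpy'.1
      linarith
    have h7 := mul_le_mul_of_nonneg_left h6 hpy.1
    have h8 := mul_le_mul_of_nonneg_left h4 (sub_nonneg.2 hpy.2)
    have h9 := mul_le_mul_of_nonneg_right (hpδ y) (sub_nonneg.2 h5)
    have h10 : BB p a (n0 + m + 2) y 0 ≤ p y * (p (y + a) * c + (1 - p (y + a)) *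
        BB p a (n0 + m) y 0) + (1 - p y) * c := by
      have : n0 + m + 2 = n0 + m + 1 + 1 := rfl
      rw [this]
      linarith
    nlinarith
  have key2 : ∀ j i, i + j = M → δ ^ j * (c - BB p a (n0 + 2 * i) x 0) ≤ 2 * η := by
    intro j
    induction j with
    | zero =>
      intro i hi
      have : i = M := by omega
      subst this
      rw [pow_zero]
      linarith
    | succ j ih =>
      intro i hi
      have h1 := ih (i + 1) (by omega)
      have h2 := key (2 * i) x
      have h3 : n0 + 2 * (i + 1) = n0 + 2 * i + 2 := by ring
      rw [h3] at h1
      have h4 := mul_le_mul_of_nonneg_left h2 (pow_nonneg hδ.le j)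
      calc _ = δ ^ j * (δ * (c - BB p a (n0 + 2 * i) x 0)) := by ring
        _ ≤ _ := h4.trans h1
  have key3 : ∀ i ∈ range M, A / 2 ≤ BB p a (n0 + 2 * i) x 0 := by
    intro i hi
    have hi' := Finset.mem_range.1 hi
    have h1 := key2 (M - i) i (by omega)
    have h2 : δ ^ M ≤ δ ^ (M - i) := pow_le_pow_of_le_one hδ.le hδ1 (by omega)
    have h3 : 0 ≤ c - BB p a (n0 + 2 * i) x 0 := sub_nonneg.2 (hle _ _)
    have h4 := mul_le_mul_of_nonneg_right h2 h3
    have h5 : δ ^ M * (c - BB p a (n0 + 2 * i) x 0) ≤ δ ^ M * (A / 2) := by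
      rw [hη] at h1; linarith
    have := le_of_mul_le_mul_left h5 hδM
    linarith
  have h1 := Finset.sum_le_sum key3
  have h2 := even_sum_le (fun i => BB p a (n0 + i) x 0) (fun i => BB_nonneg hp _ _ _) M
  have h3 := BB_sum hp hsum n0 x 0
  simp only [Finset.sum_const, Finset.card_range, nsmul_eq_mul] at h1
  have hM' : (0 : ℝ) < M := by exact_mod_cast hM
  have : (M : ℝ) * (A / 2) ≤ A / 4 * M := h1.trans (h2.trans h3)
  nlinarith [mul_pos hM' hApos]

/-- The harmonic drawdown. -/
def DD (v : UnitAddCircle → ℝ) (a x : UnitAddCircle) (d : ℕ) : ℝ :=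
  ∑ j ∈ range d, Real.exp (-v (x + (j + 1) • a))

theorem DD_up (v : UnitAddCircle → ℝ) (a x : UnitAddCircle) (d : ℕ) :
    DD v a (x + a) d = DD v a x (d + 1) - Real.exp (-v (x + a)) := by
  unfold DD
  rw [Finset.sum_range_succ']
  simp only [zero_add, one_smul, add_sub_cancel_right]
  refine Finset.sum_congr rfl fun j _ => ?_
  congr 3
  rw [succ_nsmul a (j + 1)]
  abel

theorem DD_down (v : UnitAddCircle → ℝ) (a x : UnitAddCircle) (d : ℕ) :
    DD v a (x - a) (d + 1) = DD v a x d + Real.exp (-v x) := by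
  unfold DD
  rw [Finset.sum_range_succ']
  simp only [zero_add, one_smul, sub_add_cancel]
  congr 1
  refine Finset.sum_congr rfl fun j _ => ?_
  congr 3
  rw [succ_nsmul a (j + 1)]
  abel

theorem BB_lyap (hp : ∀ x, 0 ≤ p x ∧ p x ≤ 1) {v : UnitAddCircle → ℝ} {V δ l : ℝ}
    (hv : ∀ x, |v x| ≤ V)
    (hbal : ∀ x, p x * Real.exp (-v (x + a)) = (1 - p x) * Real.exp (-v x))
    (hδ : ∀ x, δ ≤ 1 - p x) (hδ0 : 0 ≤ δ) (hl : 0 < l) (N : ℕ) (x : UnitAddCircle) (d : ℕ) :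
    δ * Real.exp (-V) * (∑ i ∈ range N, BB p a i x d) + (DD v a x d - DD v a x d ^ 2 / l) ≤
      l / 4 + Real.exp V ^ 2 * N / l := by
  have hr : ∀ y, Real.exp (-V) ≤ Real.exp (-v y) ∧ Real.exp (-v y) ≤ Real.exp V := fun y =>
    ⟨Real.exp_le_exp.2 (by linarith [(abs_le.1 (hv y)).2]),
      Real.exp_le_exp.2 (by linarith [(abs_le.1 (hv y)).1])⟩
  have hr2 : ∀ y, Real.exp (-v y) ^ 2 ≤ Real.exp V ^ 2 := fun y =>
    pow_le_pow_left₀ (Real.exp_pos _).le (hr y).2 2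
  induction N generalizing x d with
  | zero =>
    simp only [Finset.range_zero, Finset.sum_empty, mul_zero, zero_add, Nat.cast_zero, zero_div,
      add_zero]
    set D := DD v a x d
    have : 0 ≤ (D - l / 2) ^ 2 / l := by positivity
    have e : (D - l / 2) ^ 2 / l = D ^ 2 / l - D + l / 4 := by field_simp; ring
    linarith
  | succ N ih =>
    have hS : ∑ i ∈ range (N + 1), BB p a i x d = (if d = 0 then 1 else 0) +
        (p x * (∑ i ∈ range N, BB p a i (x + a) (d - 1)) +
          (1 - p x) * ∑ i ∈ range N, BB p a i (x - a) (d + 1)) := by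
      rw [Finset.sum_range_succ', add_comm, Finset.mul_sum, Finset.mul_sum,
        ← Finset.sum_add_distrib]
      rfl
    have i1 := mul_le_mul_of_nonneg_left (ih (x + a) (d - 1)) (hp x).1
    have i2 := mul_le_mul_of_nonneg_left (ih (x - a) (d + 1)) (sub_nonneg.2 (hp x).2)
    have hpx := hp x
    rw [hS]
    rw [DD_down] at i2
    push_cast
    set S1 := ∑ i ∈ range N, BB p a i (x + a) (d - 1)
    set S2 := ∑ i ∈ range N, BB p a i (x - a) (d + 1)
    set c := δ * Real.exp (-V)
    set C := Real.exp V ^ 2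
    set r0 := Real.exp (-v x)
    have hsplit : C * (N + 1) / l = C * N / l + C / l := by ring
    rw [hsplit]
    set K := l / 4 + C * N / l with hK
    rcases d with _ | d
    · have e0 : ∀ y, DD v a y 0 = 0 := fun y => by simp [DD]
      simp only [Nat.zero_sub, e0] at i1 i2 ⊢
      have h1 : c ≤ (1 - p x) * r0 := mul_le_mul (hδ x) (hr x).1 (Real.exp_pos _).le
        (sub_nonneg.2 hpx.2)
      have h2 : (1 - p x) * (r0 ^ 2 / l) ≤ C / l := by
        have : r0 ^ 2 / l ≤ C / l := by gcongr; exact hr2 x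
        have h3 : 0 ≤ r0 ^ 2 / l := by positivity
        nlinarith
      simp only [if_true]
      have i2' : (1 - p x) * (c * S2) + (1 - p x) * r0 - (1 - p x) * (r0 ^ 2 / l) ≤
          (1 - p x) * K := by
        have := i2; rw [zero_add] at this; linarith
      norm_num at i1 ⊢
      linarith
    · rw [Nat.add_sub_cancel, DD_up] at i1
      set D := DD v a x (d + 1)
      set r1 := Real.exp (-v (x + a))
      have hb : p x * r1 = (1 - p x) * r0 := hbal x
      have hq : p x * (r1 ^ 2 / l) + (1 - p x) * (r0 ^ 2 / l) ≤ C / l :=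
        conv_le hpx.1 hpx.2 (by gcongr; exact hr2 _) (by gcongr; exact hr2 _)
      have e1 : (D - r1) ^ 2 / l = D ^ 2 / l - 2 * D / l * r1 + r1 ^ 2 / l := by ring
      have e2 : (D + r0) ^ 2 / l = D ^ 2 / l + 2 * D / l * r0 + r0 ^ 2 / l := by ring
      rw [e1] at i1
      rw [e2] at i2
      have hb2 : 2 * D / l * (p x * r1) = 2 * D / l * ((1 - p x) * r0) := by rw [hb]
      simp only [Nat.succ_ne_zero, if_false, zero_add]
      linarith

theorem BB_avg (hp : ∀ x, 0 ≤ p x ∧ p x ≤ 1) {v : UnitAddCircle → ℝ} {V δ : ℝ}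
    (hv : ∀ x, |v x| ≤ V)
    (hbal : ∀ x, p x * Real.exp (-v (x + a)) = (1 - p x) * Real.exp (-v x))
    (hδ : ∀ x, δ ≤ 1 - p x) (hδ0 : 0 < δ) (ε : ℝ) (hε : 0 < ε) :
    ∃ M > 0, ∀ x, ∑ i ∈ range (2 * M), BB p a i x 0 ≤ ε * M := by
  set c := δ * Real.exp (-V) with hc
  have hcpos : 0 < c := by positivity
  set C := Real.exp V ^ 2 with hC
  have hCpos : 0 < C := by positivity
  set l := 4 * C / (c * ε) with hl
  have hlpos : 0 < l := by positivity
  obtain ⟨M, hM⟩ := exists_nat_gt (l / (2 * c * ε))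
  have hM0 : (0 : ℝ) < M := lt_of_le_of_lt (by positivity) hM
  refine ⟨M, by exact_mod_cast hM0, fun x => ?_⟩
  have h := BB_lyap hp hv hbal hδ hδ0.le hlpos (2 * M) x 0
  have e0 : DD v a x 0 = 0 := by simp [DD]
  rw [e0] at h
  push_cast at h
  have h1 : C * (2 * M) / l = c * ε * M / 2 := by
    rw [hl]; field_simp; ring
  rw [div_lt_iff₀ (by positivity)] at hM
  have h2 : c * (∑ i ∈ range (2 * M), BB p a i x 0) ≤ c * (ε * M) := by
    rw [h1] at h
    norm_num at h
    linarith
  exact le_of_mul_le_mul_left h2 hcpos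

end BBlemmas

section PathLemmas

theorem BB_close {p p' : UnitAddCircle → ℝ} {a : UnitAddCircle} {η : ℝ}
    (hp : ∀ x, 0 ≤ p x ∧ p x ≤ 1) (hp' : ∀ x, 0 ≤ p' x ∧ p' x ≤ 1)
    (h : ∀ x, |p x - p' x| ≤ η) (n : ℕ) (x : UnitAddCircle) (d : ℕ) :
    |BB p a n x d - BB p' a n x d| ≤ n * η := by
  induction n generalizing x d with
  | zero => simp [BB]
  | succ n ih =>
    have h1 := ih (x + a) (d - 1)
    have h2 := ih (x - a) (d + 1)
    have u0 := BB_nonneg (a := a) hp' n (x + a) (d - 1)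
    have u1 := BB_le_one (a := a) hp' n (x + a) (d - 1)
    have w0 := BB_nonneg (a := a) hp' n (x - a) (d + 1)
    have w1 := BB_le_one (a := a) hp' n (x - a) (d + 1)
    have hpx := hp x
    simp only [BB]
    push_cast
    set u := BB p a n (x + a) (d - 1)
    set u' := BB p' a n (x + a) (d - 1)
    set w := BB p a n (x - a) (d + 1)
    set w' := BB p' a n (x - a) (d + 1)
    have e : p x * u + (1 - p x) * w - (p' x * u' + (1 - p' x) * w') =
        (p x * (u - u') + (1 - p x) * (w - w')) + (p x - p' x) * (u' - w') := by ring
    have h3 : |(p x - p' x) * (u' - w')| ≤ η := by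
      rw [abs_mul]
      have : |u' - w'| ≤ 1 := abs_le.2 ⟨by linarith, by linarith⟩
      calc _ ≤ |p x - p' x| * 1 := by gcongr
        _ ≤ η := by linarith [h x]
    have h4 : |p x * (u - u') + (1 - p x) * (w - w')| ≤ n * η := by
      refine (abs_add_le _ _).trans ?_
      rw [abs_mul, abs_mul, abs_of_nonneg hpx.1, abs_of_nonneg (sub_nonneg.2 hpx.2)]
      exact conv_le hpx.1 hpx.2 h1 h2
    rw [e]
    refine (abs_add_le _ _).trans ?_
    linarith

theorem pOf_pos (f : UnitAddCircle → ℝ) (x : UnitAddCircle) : 0 < pOf f x := by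
  unfold pOf; positivity

theorem one_sub_pOf (f : UnitAddCircle → ℝ) (x : UnitAddCircle) :
    1 - pOf f x = pOf (fun z => -f z) x := by
  unfold pOf
  simp only [Real.exp_neg]
  have := Real.exp_pos (f x)
  field_simp
  ring

theorem pOf_mem (f : UnitAddCircle → ℝ) (x : UnitAddCircle) : 0 ≤ pOf f x ∧ pOf f x ≤ 1 := by
  have h1 := pOf_pos f x
  have h2 := pOf_pos (fun z => -f z) x
  rw [← one_sub_pOf] at h2
  exact ⟨h1.le, by linarith⟩

theorem pOf_lower {f : UnitAddCircle → ℝ} {F : ℝ} {x : UnitAddCircle} (h : |f x| ≤ F) :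
    Real.exp (-F) / (1 + Real.exp F) ≤ pOf f x := by
  unfold pOf
  have := abs_le.1 h
  gcongr
  · linarith
  · linarith

theorem sig_lip {s t : ℝ} (h : t ≤ s) :
    |Real.exp s / (1 + Real.exp s) - Real.exp t / (1 + Real.exp t)| ≤ s - t := by
  have hs := Real.exp_pos s
  have ht := Real.exp_pos t
  have hst : Real.exp t ≤ Real.exp s := Real.exp_le_exp.2 h
  have e : Real.exp s / (1 + Real.exp s) - Real.exp t / (1 + Real.exp t) =
      (Real.exp s - Real.exp t) / ((1 + Real.exp s) * (1 + Real.exp t)) := by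
    field_simp
    ring
  rw [e, abs_of_nonneg (div_nonneg (by linarith) (by positivity)), div_le_iff₀ (by positivity)]
  have h1 : t - s + 1 ≤ Real.exp (t - s) := Real.add_one_le_exp _
  have h2 : Real.exp t = Real.exp s * Real.exp (t - s) := by rw [← Real.exp_add]; ring_nf
  have h3 : Real.exp s - Real.exp t ≤ Real.exp s * (s - t) := by
    nlinarith [mul_le_mul_of_nonneg_left h1 hs.le]
  have h4 : 0 ≤ (s - t) * (1 + Real.exp t + Real.exp s * Real.exp t) :=
    mul_nonneg (by linarith) (by positivity)
  nlinarith

theorem pOf_lip (f g : UnitAddCircle → ℝ) (x : UnitAddCircle) :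
    |pOf f x - pOf g x| ≤ |f x - g x| := by
  unfold pOf
  rcases le_total (g x) (f x) with h | h
  · rw [abs_of_nonneg (sub_nonneg.2 h)]
    exact sig_lip h
  · rw [abs_sub_comm, abs_sub_comm (f x), abs_of_nonneg (sub_nonneg.2 h)]
    exact sig_lip h

theorem stepProb_nonneg {p : UnitAddCircle → ℝ} (hp : ∀ x, 0 ≤ p x ∧ p x ≤ 1) (α : ℝ)
    (x : UnitAddCircle) (i j : ℤ) : 0 ≤ stepProb p α x i j := by
  unfold stepProb
  split_ifs
  · exact (hp _).1
  · exact sub_nonneg.2 (hp _).2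
  · exact le_rfl

theorem pre_succ {p : UnitAddCircle → ℝ} {α : ℝ} {x : UnitAddCircle} {Ω : Type}
    [MeasurableSpace Ω] {ℙ : Measure Ω} {ξ : ℕ → Ω → ℤ} (hw : IsQPWalk p α x 0 ℙ ξ)
    (hp : ∀ x, 0 ≤ p x ∧ p x ≤ 1) (m : ℕ) (k : ℕ → ℤ) (j : ℤ) :
    ℙ {ω | ∀ i ≤ m + 1, ξ i ω = Function.update k (m + 1) j i} =
      ℙ {ω | ∀ i ≤ m, ξ i ω = k i} * ENNReal.ofReal (stepProb p α x (k m) j) := by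
  have hu : ∀ i ≤ m, Function.update k (m + 1) j i = k i := fun i hi =>
    Function.update_of_ne (by omega) _ _
  rw [hw.2.2, hw.2.2, Finset.prod_range_succ, ← mul_assoc, ENNReal.ofReal_mul,
    hu 0 (Nat.zero_le _), hu m le_rfl, Function.update_self]
  · congr 3
    refine Finset.prod_congr rfl fun i hi => ?_
    have := Finset.mem_range.1 hi
    rw [hu i (by omega), hu (i + 1) (by omega)]
  · refine mul_nonneg (by split_ifs <;> norm_num) (Finset.prod_nonneg fun i _ => ?_)
    exact stepProb_nonneg hp _ _ _ _

theorem path_le {p : UnitAddCircle → ℝ} {α : ℝ} {x : UnitAddCircle} {Ω : Type}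
    [MeasurableSpace Ω] {ℙ : Measure Ω} {ξ : ℕ → Ω → ℤ} (hw : IsQPWalk p α x 0 ℙ ξ)
    (hp : ∀ x, 0 ≤ p x ∧ p x ≤ 1) (n : ℕ) : ∀ (m : ℕ) (k : ℕ → ℤ) (d : ℕ),
    (∃ i ≤ m, k m + d ≤ k i) →
    ℙ ({ω | ∀ i ≤ m, ξ i ω = k i} ∩ {ω | ∀ j ≤ m + n, ξ j ω ≤ ξ (m + n) ω}) ≤
      ℙ {ω | ∀ i ≤ m, ξ i ω = k i} *
        ENNReal.ofReal (BB p (α : UnitAddCircle) n (pt α x (k m)) d) := by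
  induction n with
  | zero =>
    rintro m k d ⟨i, hi, hk⟩
    simp only [BB]
    split_ifs with hd
    · rw [ENNReal.ofReal_one, mul_one]
      exact measure_mono Set.inter_subset_left
    · rw [ENNReal.ofReal_zero, mul_zero]
      refine (le_of_eq ?_)
      convert measure_empty (μ := ℙ)
      ext ω
      simp only [Set.mem_inter_iff, Set.mem_ofPred_eq, Set.mem_empty_iff_false, iff_false, not_and]
      intro h1 h2
      have h3 := h2 i (by omega)
      rw [add_zero, h1 i hi, h1 m le_rfl] at h3
      omega
  | succ n ih =>
    rintro m k d ⟨i, hi, hk⟩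
    set E := {ω | ∀ j ≤ m + (n + 1), ξ j ω ≤ ξ (m + (n + 1)) ω} with hE
    have hEeq : E = {ω | ∀ j ≤ m + 1 + n, ξ j ω ≤ ξ (m + 1 + n) ω} := by
      rw [hE, show m + (n + 1) = m + 1 + n by ring]
    set P := fun j : ℤ => {ω | ∀ i ≤ m + 1, ξ i ω = Function.update k (m + 1) j i} with hP
    have hu : ∀ j, ∀ i ≤ m, Function.update k (m + 1) j i = k i := fun j i hi =>
      Function.update_of_ne (by omega) _ _
    have hcover : {ω | ∀ i ≤ m, ξ i ω = k i} ∩ E ⊆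
        (P (k m + 1) ∩ E) ∪ ((P (k m - 1) ∩ E) ∪
          ⋃ j : {j : ℤ // j ≠ k m + 1 ∧ j ≠ k m - 1}, P j) := by
      rintro ω ⟨h1, h2⟩
      have hin : ω ∈ P (ξ (m + 1) ω) := by
        intro i hi
        rcases Nat.lt_or_ge m i with h | h
        · have : i = m + 1 := by omega
          subst this
          rw [Function.update_self]
        · rw [hu _ i h]; exact h1 i h
      by_cases ha : ξ (m + 1) ω = k m + 1
      · left; rw [ha] at hin; exact ⟨hin, h2⟩
      · by_cases hb : ξ (m + 1) ω = k m - 1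
        · right; left; rw [hb] at hin; exact ⟨hin, h2⟩
        · right; right
          exact Set.mem_iUnion.2 ⟨⟨_, ha, hb⟩, hin⟩
    have hnull : ℙ (⋃ j : {j : ℤ // j ≠ k m + 1 ∧ j ≠ k m - 1}, P j) = 0 := by
      rw [measure_iUnion_null_iff]
      rintro ⟨j, hj1, hj2⟩
      simp only [hP]
      rw [pre_succ hw hp]
      simp [stepProb, hj1, hj2]
    have hup := ih (m + 1) (Function.update k (m + 1) (k m + 1)) (d - 1) (by
      rw [Function.update_self]
      rcases Nat.eq_zero_or_pos d with h | h
      · refine ⟨m + 1, le_rfl, ?_⟩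
        rw [Function.update_self]
        subst h; simp
      · refine ⟨i, by omega, ?_⟩
        rw [hu _ i hi]
        omega)
    have hdn := ih (m + 1) (Function.update k (m + 1) (k m - 1)) (d + 1) (by
      rw [Function.update_self]
      refine ⟨i, by omega, ?_⟩
      rw [hu _ i hi]
      push_cast
      omega)
    rw [← hEeq, pre_succ hw hp, Function.update_self] at hup hdn
    have hpu : pt α x (k m + 1) = pt α x (k m) + (α : UnitAddCircle) := by
      unfold pt
      push_cast
      rw [add_mul, one_mul, AddCircle.coe_add, add_assoc]
    have hpd : pt α x (k m - 1) = pt α x (k m) - (α : UnitAddCircle) := by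
      unfold pt
      push_cast
      rw [sub_mul, one_mul, AddCircle.coe_sub, add_sub_assoc]
    have hs1 : stepProb p α x (k m) (k m + 1) = p (pt α x (k m)) := by simp [stepProb]
    have hs2 : stepProb p α x (k m) (k m - 1) = 1 - p (pt α x (k m)) := by
      unfold stepProb
      rw [if_neg (by omega), if_pos rfl]
    rw [hs1, hpu] at hup
    rw [hs2, hpd] at hdn
    calc ℙ ({ω | ∀ i ≤ m, ξ i ω = k i} ∩ E)
        ≤ ℙ (P (k m + 1) ∩ E) + (ℙ (P (k m - 1) ∩ E) + 0) := by
          rw [← hnull]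
          exact (measure_mono hcover).trans ((measure_union_le _ _).trans
            (add_le_add le_rfl (measure_union_le _ _)))
      _ ≤ _ := by
          rw [add_zero]
          refine (add_le_add hup hdn).trans ?_
          have hpx := hp (pt α x (k m))
          rw [mul_assoc, mul_assoc, ← mul_add, ← ENNReal.ofReal_mul hpx.1,
            ← ENNReal.ofReal_mul (sub_nonneg.2 hpx.2), ← ENNReal.ofReal_add]
          · exact le_rfl
          · exact mul_nonneg hpx.1 (BB_nonneg hp _ _ _)
          · exact mul_nonneg (sub_nonneg.2 hpx.2) (BB_nonneg hp _ _ _)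

theorem prob_max_le {p : UnitAddCircle → ℝ} {α : ℝ} {x : UnitAddCircle} {Ω : Type}
    [MeasurableSpace Ω] {ℙ : Measure Ω} {ξ : ℕ → Ω → ℤ} (hw : IsQPWalk p α x 0 ℙ ξ)
    (hp : ∀ x, 0 ≤ p x ∧ p x ≤ 1) (n : ℕ) :
    (ℙ {ω | ∀ j ≤ n, ξ j ω ≤ ξ n ω}).toReal ≤ BB p (α : UnitAddCircle) n x 0 := by
  have := hw.1
  have h := path_le hw hp n 0 (fun _ => 0) 0 ⟨0, le_rfl, by simp⟩
  have hpt : pt α x 0 = x := by simp [pt]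
  simp only [hpt, zero_add] at h
  have h1 : ℙ {ω | ∀ i ≤ 0, ξ i ω = 0} = 1 := by
    have := hw.2.2 0 (fun _ => 0)
    simpa using this
  rw [h1, one_mul] at h
  have h2 : ℙ ({ω | ∀ i ≤ 0, ξ i ω = 0}ᶜ) = 0 := by
    rw [prob_compl_eq_zero_iff, h1]
    have e : {ω | ∀ i ≤ 0, ξ i ω = 0} = ξ 0 ⁻¹' {0} := by ext ω; simp
    rw [e]
    exact hw.2.1 0 (MeasurableSet.singleton 0)
  have h3 : ℙ {ω | ∀ j ≤ n, ξ j ω ≤ ξ n ω} ≤ ENNReal.ofReal (BB p (α : UnitAddCircle) n x 0) := by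
    refine (measure_le_inter_add_diff ℙ _ {ω | ∀ i ≤ 0, ξ i ω = 0}).trans ?_
    rw [Set.inter_comm]
    refine (add_le_add h (measure_mono (t := {ω | ∀ i ≤ 0, ξ i ω = 0}ᶜ) fun ω h => h.2)).trans ?_
    rw [h2, add_zero]
  exact ENNReal.toReal_le_of_le_ofReal (BB_nonneg hp _ _ _) h3

theorem walk_neg {p : UnitAddCircle → ℝ} {α : ℝ} {x : UnitAddCircle} {Ω : Type}
    [MeasurableSpace Ω] {ℙ : Measure Ω} {ξ : ℕ → Ω → ℤ} (hw : IsQPWalk p α x 0 ℙ ξ) :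
    IsQPWalk (fun z => 1 - p z) (-α) x 0 ℙ (fun n ω => -ξ n ω) := by
  refine ⟨hw.1, fun n => (hw.2.1 n).neg, fun n k => ?_⟩
  have h := hw.2.2 n (fun i => -k i)
  have e : {ω | ∀ i ≤ n, -ξ i ω = k i} = {ω | ∀ i ≤ n, ξ i ω = -k i} := by
    ext ω
    simp only [Set.mem_ofPred_eq, neg_eq_iff_eq_neg]
  rw [e, h]
  congr 2
  · simp
  · refine Finset.prod_congr rfl fun i _ => ?_
    have hpt : pt (-α) x (k i) = pt α x (-k i) := by
      unfold pt
      push_cast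
      ring_nf
    unfold stepProb
    rw [hpt]
    split_ifs <;> first | omega | ring

end PathLemmas

section Density

theorem ac_of_frozen {F : ℝ → ℝ} (h : AbsolutelyContinuousOn01 F) :
    AbsolutelyContinuousOnInterval F 0 1 := by
  rw [absolutelyContinuousOnInterval_iff]
  intro ε hε
  obtain ⟨δ, hδ, H⟩ := h ε hε
  refine ⟨δ, hδ, ?_⟩
  rintro ⟨n, I⟩ ⟨h1, h2⟩ hsum
  simp only [Set.uIcc_of_le zero_le_one, Finset.mem_range] at h1
  simp only at hsum
  have key := H n (fun i => min (I i).1 (I i).2) (fun i => max (I i).1 (I i).2) ?_ ?_ ?_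
  · rw [Finset.sum_range]
    refine lt_of_eq_of_lt (Finset.sum_congr rfl fun i _ => ?_) key
    rcases le_total (I i).1 (I i).2 with h | h
    · simp only [min_eq_left h, max_eq_right h, Real.dist_eq, abs_sub_comm]
    · simp only [min_eq_right h, max_eq_left h, Real.dist_eq]
  · intro i
    obtain ⟨ha, hb⟩ := h1 i i.2
    refine ⟨⟨le_min ha.1 hb.1, (min_le_left _ _).trans ha.2⟩,
      ⟨ha.1.trans (le_max_left _ _), max_le ha.2 hb.2⟩, min_le_max⟩
  · intro i j hij
    have := h2 (Finset.mem_coe.2 (Finset.mem_range.2 i.2))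
      (Finset.mem_coe.2 (Finset.mem_range.2 j.2)) (fun h => hij (Fin.ext h))
    exact this.mono Set.Ioo_subset_Ioc_self Set.Ioo_subset_Ioc_self
  · rw [Finset.sum_range] at hsum
    refine lt_of_eq_of_lt (Finset.sum_congr rfl fun i _ => ?_) hsum
    rw [Real.dist_eq, max_sub_min_eq_abs, abs_sub_comm]

theorem frozen_of_lip {F : ℝ → ℝ} {K : ℝ} (hK : 0 < K) (h : ∀ s t, |F t - F s| ≤ K * |t - s|) :
    AbsolutelyContinuousOn01 F := by
  intro ε hε
  refine ⟨ε / K, by positivity, ?_⟩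
  intro n a b hab _ hsum
  calc ∑ i, |F (b i) - F (a i)| ≤ ∑ i, K * (b i - a i) := by
        refine Finset.sum_le_sum fun i _ => ?_
        have := h (a i) (b i)
        rwa [abs_of_nonneg (sub_nonneg.2 (hab i).2.2)] at this
    _ = K * ∑ i, (b i - a i) := by rw [Finset.mul_sum]
    _ < ε := by rwa [lt_div_iff₀ hK, mul_comm] at hsum

theorem fourier_ne_one {α : ℝ} (hα : Irrational α) {n : ℤ} (hn : n ≠ 0) :
    fourier n (α : UnitAddCircle) ≠ 1 := by
  rw [fourier_coe_apply, Ne, Complex.exp_eq_one_iff]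
  rintro ⟨m, hm⟩
  have h1 : (n : ℂ) * α = m := by
    have h2 : (2 * Real.pi * Complex.I : ℂ) ≠ 0 := Complex.two_pi_I_ne_zero
    apply mul_left_cancel₀ h2
    rw [mul_comm _ (m : ℂ), ← hm]
    push_cast
    ring
  have h2 : (n : ℝ) * α = m := by exact_mod_cast h1
  exact (hα.intCast_mul hn).ne_int m h2

theorem trig_cob {α : ℝ} (hα : Irrational α) (P : C(UnitAddCircle, ℂ))
    (hP : P ∈ Submodule.span ℂ (Set.range (@fourier 1))) :
    ∃ (c : ℂ) (g v : C(UnitAddCircle, ℂ)),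
      (∀ t : ℝ, HasDerivAt (fun s : ℝ => g (s : UnitAddCircle)) (P (t : UnitAddCircle) - c) t) ∧
      ∀ x, g x = v (x + (α : UnitAddCircle)) - v x := by
  induction hP using Submodule.span_induction with
  | mem P h =>
    obtain ⟨n, rfl⟩ := h
    by_cases hn : n = 0
    · subst hn
      refine ⟨1, 0, 0, fun t => ?_, fun x => by simp⟩
      simpa using hasDerivAt_const t (0 : ℂ)
    · set κ : ℂ := 2 * Real.pi * Complex.I * n with hκ
      have hκ0 : κ ≠ 0 := mul_ne_zero Complex.two_pi_I_ne_zero (by exact_mod_cast hn)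
      have hf1 : fourier n (α : UnitAddCircle) - 1 ≠ 0 := sub_ne_zero.2 (fourier_ne_one hα hn)
      refine ⟨0, κ⁻¹ • fourier n, (κ⁻¹ / (fourier n (α : UnitAddCircle) - 1)) • fourier n,
        fun t => ?_, fun x => ?_⟩
      · have := (hasDerivAt_fourier 1 n t).const_mul κ⁻¹
        simp only [ContinuousMap.smul_apply, smul_eq_mul, sub_zero]
        convert! this using 1
        rw [← hκ]
        push_cast
        field_simp
      · have hadd : fourier n (x + (α : UnitAddCircle)) =
            fourier n x * fourier n (α : UnitAddCircle) := by
          simp only [fourier_apply, smul_add, AddCircle.toCircle_add, Circle.coe_mul]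
        simp only [ContinuousMap.smul_apply, smul_eq_mul, hadd]
        field_simp
  | zero =>
    refine ⟨0, 0, 0, fun t => ?_, fun x => by simp⟩
    simpa using hasDerivAt_const t (0 : ℂ)
  | add P Q _ _ hP hQ =>
    obtain ⟨c, g, v, h1, h2⟩ := hP
    obtain ⟨c', g', v', h1', h2'⟩ := hQ
    refine ⟨c + c', g + g', v + v', fun t => ?_, fun x => ?_⟩
    · convert! (h1 t).add (h1' t) using 1
      simp only [ContinuousMap.add_apply]
      ring
    · simp only [ContinuousMap.add_apply, h2, h2']
      ring
  | smul z P _ hP =>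
    obtain ⟨c, g, v, h1, h2⟩ := hP
    refine ⟨z * c, z • g, z • v, fun t => ?_, fun x => ?_⟩
    · convert! (h1 t).const_mul z using 1
      simp only [ContinuousMap.smul_apply, smul_eq_mul]
      ring
    · simp only [ContinuousMap.smul_apply, smul_eq_mul, h2]
      ring

theorem real_univ : (volume : Measure UnitAddCircle).real Set.univ = 1 := by
  simp [Measure.real, UnitAddCircle.measure_univ]

theorem l1_approx {φ : ℝ → ℝ} (hφ : IntervalIntegrable φ volume 0 1) {ε : ℝ} (hε : 0 < ε) :
    ∃ P ∈ Submodule.span ℂ (Set.range (@fourier 1)),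
      ∫ t in (0 : ℝ)..1, ‖(φ t : ℂ) - P (t : UnitAddCircle)‖ ≤ ε := by
  set L : UnitAddCircle → ℂ := AddCircle.liftIoc 1 0 (fun t => (φ t : ℂ)) with hL
  have hφ' : MemLp (fun t => (φ t : ℂ)) 1 (volume.restrict (Set.Ioc (0 : ℝ) (0 + 1))) := by
    rw [memLp_one_iff_integrable, zero_add]
    exact ((intervalIntegrable_iff_integrableOn_Ioc_of_le zero_le_one).1 hφ).ofReal
  have hLi : Integrable L := memLp_one_iff_integrable.1 hφ'.memLp_liftIoc
  obtain ⟨g, hg, hgi⟩ := hLi.exists_boundedContinuous_integral_sub_le (half_pos hε)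
  have hmem : g.toContinuousMap ∈
      (Submodule.span ℂ (Set.range (@fourier 1))).topologicalClosure := by
    rw [span_fourier_closure_eq_top]; trivial
  have hmem' : g.toContinuousMap ∈
      closure (Submodule.span ℂ (Set.range (@fourier 1)) : Set C(UnitAddCircle, ℂ)) := hmem
  obtain ⟨P, hP, hdist⟩ := Metric.mem_closure_iff.1 hmem' (ε / 2) (half_pos hε)
  refine ⟨P, hP, ?_⟩
  have hPi : Integrable (fun x => P x) (volume : Measure UnitAddCircle) :=
    P.continuous.integrable_of_hasCompactSupport (HasCompactSupport.of_compactSpace _)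
  have e1 : ∫ t in (0 : ℝ)..1, ‖(φ t : ℂ) - P (t : UnitAddCircle)‖ = ∫ x, ‖L x - P x‖ := by
    rw [← UnitAddCircle.intervalIntegral_preimage 0, zero_add]
    apply intervalIntegral.integral_congr_ae
    refine .of_forall fun t ht => ?_
    rw [Set.uIoc_of_le zero_le_one] at ht
    simp only [hL]
    rw [AddCircle.liftIoc_coe_apply (by simpa using ht)]
  rw [e1]
  calc ∫ x, ‖L x - P x‖ ≤ ∫ x, (‖L x - g x‖ + ε / 2) := by
        refine integral_mono (hLi.sub hPi).norm ((hLi.sub hgi).norm.add (integrable_const _)) ?_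
        intro x
        have h1 : ‖g x - P x‖ ≤ ε / 2 := by
          have := ContinuousMap.dist_apply_le_dist (f := g.toContinuousMap) (g := P) x
          rw [dist_eq_norm] at this
          exact this.trans hdist.le
        have h2 := norm_sub_le_norm_sub_add_norm_sub (L x) (g x) (P x)
        simp only
        linarith
    _ = (∫ x, ‖L x - g x‖) + ε / 2 := by
        have hi : Integrable (fun x => ‖L x - g x‖) := (hLi.sub hgi).norm
        rw [integral_add hi (integrable_const _)]
        simp [real_univ]
    _ ≤ ε := by linarith

theorem evar_le {H Φ : ℝ → ℝ} {K : ℝ}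
    (h : ∀ s t, 0 ≤ s → s ≤ t → t ≤ 1 → |H t - H s| ≤ Φ t - Φ s) (hK : Φ 1 - Φ 0 ≤ K) :
    eVariationOn H (Set.Icc 0 1) ≤ ENNReal.ofReal K := by
  unfold eVariationOn
  refine iSup_le ?_
  rintro ⟨n, u, hu, hmem⟩
  simp only
  have hΦ : ∀ s t, 0 ≤ s → s ≤ t → t ≤ 1 → Φ s ≤ Φ t := fun s t h0 h1 h2 =>
    sub_nonneg.1 ((abs_nonneg _).trans (h s t h0 h1 h2))
  calc ∑ i ∈ range n, edist (H (u (i + 1))) (H (u i))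
      ≤ ∑ i ∈ range n, ENNReal.ofReal (Φ (u (i + 1)) - Φ (u i)) := by
        refine Finset.sum_le_sum fun i _ => ?_
        rw [edist_dist, Real.dist_eq]
        exact ENNReal.ofReal_le_ofReal
          (h _ _ (hmem i).1 (hu (Nat.le_succ i)) (hmem (i + 1)).2)
    _ = ENNReal.ofReal (∑ i ∈ range n, (Φ (u (i + 1)) - Φ (u i))) := by
        rw [ENNReal.ofReal_sum_of_nonneg]
        intro i _
        exact sub_nonneg.2 (hΦ _ _ (hmem i).1 (hu (Nat.le_succ i)) (hmem (i + 1)).2)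
    _ ≤ ENNReal.ofReal K := by
        refine ENNReal.ofReal_le_ofReal ?_
        rw [Finset.sum_range_sub (fun i => Φ (u i))]
        have h1 := hΦ (u n) 1 (hmem n).1 (hmem n).2 le_rfl
        have h2 := hΦ 0 (u 0) le_rfl (hmem 0).1 (hmem 0).2
        linarith

theorem dense_cob {α : ℝ} (hα : Irrational α) {f : UnitAddCircle → ℝ} (hf : memP f) {ε : ℝ}
    (hε : 0 < ε) : ∃ g : UnitAddCircle → ℝ, ∃ v : UnitAddCircle → ℝ, memP g ∧
      bvNorm (fun z => f z - g z) < ε ∧ Continuous v ∧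
      ∀ x, g x = v (x + (α : UnitAddCircle)) - v x := by
  obtain ⟨hfc, hfac, hfi⟩ := hf
  set F : ℝ → ℝ := fun t => f (t : UnitAddCircle) with hF
  have hFac := ac_of_frozen hfac
  have hφ := hFac.intervalIntegrable_deriv
  set ε' := ε / 8 with hε'
  have hε'0 : 0 < ε' := by positivity
  obtain ⟨P, hP, hPε⟩ := l1_approx hφ hε'0
  obtain ⟨c, g, v, hder, hcob⟩ := trig_cob hα P hP
  set G : ℝ → ℝ := fun t => (g (t : UnitAddCircle)).re with hG
  have hGder : ∀ t : ℝ, HasDerivAt G ((P (t : UnitAddCircle)).re - c.re) t := by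
    intro t
    have := Complex.reCLM.hasFDerivAt.comp_hasDerivAt t (hder t)
    simpa using! this
  have hPc : Continuous fun t : ℝ => P (t : UnitAddCircle) :=
    P.continuous.comp (AddCircle.continuous_mk' 1)
  have hPr : Continuous fun t : ℝ => (P (t : UnitAddCircle)).re :=
    Complex.continuous_re.comp hPc
  have hone : ((1 : ℝ) : UnitAddCircle) = ((0 : ℝ) : UnitAddCircle) := by simp
  -- norm of `c.re`
  have hGint : ∀ s t : ℝ, ∫ r in s..t, ((P (r : UnitAddCircle)).re - c.re) = G t - G s := by
    intro s t
    exact intervalIntegral.integral_eq_sub_of_hasDerivAt (fun r _ => hGder r)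
      ((hPr.sub continuous_const).intervalIntegrable _ _)
  have hFint : ∀ s t, 0 ≤ s → s ≤ t → t ≤ 1 → ∫ r in s..t, deriv F r = F t - F s := by
    intro s t h0 h1 h2
    refine (hFac.mono ?_).integral_deriv_eq_sub
    rw [Set.uIcc_of_le h1, Set.uIcc_of_le zero_le_one]
    exact Set.Icc_subset_Icc h0 h2
  have hdi : IntervalIntegrable (fun t : ℝ => ‖((deriv F t : ℝ) : ℂ) - P (t : UnitAddCircle)‖)
      volume 0 1 := by
    refine IntervalIntegrable.norm (IntervalIntegrable.sub ?_ (hPc.intervalIntegrable _ _))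
    rw [intervalIntegrable_iff] at hφ ⊢
    exact hφ.ofReal
  have hre : ∀ t : ℝ, |deriv F t - (P (t : UnitAddCircle)).re| ≤
      ‖((deriv F t : ℝ) : ℂ) - P (t : UnitAddCircle)‖ := by
    intro t
    have := Complex.abs_re_le_norm (((deriv F t : ℝ) : ℂ) - P (t : UnitAddCircle))
    simpa using this
  have hdr : IntervalIntegrable (fun t : ℝ => deriv F t - (P (t : UnitAddCircle)).re) volume 0 1 :=
    hφ.sub (hPr.intervalIntegrable _ _)
  have hcre : |c.re| ≤ ε' := by
    have h1 : ∫ t in (0 : ℝ)..1, (deriv F t - (P (t : UnitAddCircle)).re) = - c.re := by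
      have h2 := hGint 0 1
      have h3 := hFint 0 1 le_rfl zero_le_one le_rfl
      rw [intervalIntegral.integral_sub (hPr.intervalIntegrable _ _)
        (intervalIntegrable_const)] at h2
      rw [intervalIntegral.integral_sub hφ (hPr.intervalIntegrable _ _), h3]
      simp only [hG, hF, hone, sub_self, intervalIntegral.integral_const, smul_eq_mul,
        sub_zero, one_mul] at h2 ⊢
      linarith
    rw [← abs_neg, ← h1]
    refine (intervalIntegral.abs_integral_le_integral_abs zero_le_one).trans ?_
    refine le_trans ?_ hPε
    exact intervalIntegral.integral_mono_on zero_le_one hdr.abs hdi fun t _ => hre t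
  set ψ : ℝ → ℝ := fun t : ℝ => ‖((deriv F t : ℝ) : ℂ) - P (t : UnitAddCircle)‖ + ε' with hψ
  have hψi : IntervalIntegrable ψ volume 0 1 := hdi.add intervalIntegrable_const
  have hψi' : ∀ s t, 0 ≤ s → s ≤ t → t ≤ 1 → IntervalIntegrable ψ volume s t := by
    intro s t h0 h1 h2
    refine hψi.mono_set ?_
    rw [Set.uIcc_of_le h1, Set.uIcc_of_le zero_le_one]
    exact Set.Icc_subset_Icc h0 h2
  set Φ : ℝ → ℝ := fun t => ∫ r in (0 : ℝ)..t, ψ r with hΦ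
  have hΦ1 : Φ 1 - Φ 0 ≤ 2 * ε' := by
    simp only [hΦ, intervalIntegral.integral_same, sub_zero, hψ]
    rw [intervalIntegral.integral_add hdi intervalIntegrable_const]
    simp only [intervalIntegral.integral_const, smul_eq_mul, sub_zero, one_mul]
    linarith
  have hH : ∀ s t, 0 ≤ s → s ≤ t → t ≤ 1 →
      |(fun t => F t - G t) t - (fun t => F t - G t) s| ≤ Φ t - Φ s := by
    intro s t h0 h1 h2
    have hsub : Set.uIcc s t ⊆ Set.uIcc 0 1 := by
      rw [Set.uIcc_of_le h1, Set.uIcc_of_le zero_le_one]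
      exact Set.Icc_subset_Icc h0 h2
    have hi1 : IntervalIntegrable (deriv F) volume s t := hφ.mono_set hsub
    have hi2 : IntervalIntegrable (fun r : ℝ => (P (r : UnitAddCircle)).re - c.re) volume s t :=
      (hPr.sub continuous_const).intervalIntegrable _ _
    have e1 : (F t - G t) - (F s - G s) =
        ∫ r in s..t, (deriv F r - ((P (r : UnitAddCircle)).re - c.re)) := by
      rw [intervalIntegral.integral_sub hi1 hi2, hFint s t h0 h1 h2, hGint]
      ring
    have e2 : Φ t - Φ s = ∫ r in s..t, ψ r :=
      intervalIntegral.integral_interval_sub_left (hψi' 0 t le_rfl (h0.trans h1) h2)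
        (hψi' 0 s le_rfl h0 (h1.trans h2))
    simp only
    rw [e1, e2]
    refine (intervalIntegral.abs_integral_le_integral_abs h1).trans ?_
    refine intervalIntegral.integral_mono_on h1 (hi1.sub hi2).abs (hψi' s t h0 h1 h2) ?_
    intro r _
    have h3 : deriv F r - ((P (r : UnitAddCircle)).re - c.re) =
        (deriv F r - (P (r : UnitAddCircle)).re) + c.re := by ring
    rw [h3]
    exact (abs_add_le _ _).trans (add_le_add (hre r) hcre)
  have hgc : Continuous fun x => (g x).re := Complex.continuous_re.comp g.continuous
  have hvc : Continuous fun x => (v x).re := Complex.continuous_re.comp v.continuous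
  have hint : ∀ {h : UnitAddCircle → ℝ}, Continuous h → Integrable h volume := fun hh =>
    hh.integrable_of_hasCompactSupport (HasCompactSupport.of_compactSpace _)
  have hgcob : ∀ x, (g x).re = (v (x + (α : UnitAddCircle))).re - (v x).re := by
    intro x; rw [hcob x, Complex.sub_re]
  have hg0 : ∫ z : UnitAddCircle, (g z).re = 0 := by
    simp only [hgcob]
    have hvc' : Continuous fun x => (v (x + (α : UnitAddCircle))).re :=
      hvc.comp (continuous_add_const _)
    rw [integral_sub (hint hvc') (hint hvc),
      integral_add_right_eq_self (fun x => (v x).re), sub_self]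
  have hmemg : memP fun x => (g x).re := by
    refine ⟨hgc, ?_, hg0⟩
    refine frozen_of_lip (K := ‖P‖ + ‖c‖ + 1) (by positivity) fun s t => ?_
    have := (convex_univ : Convex ℝ (Set.univ : Set ℝ)).norm_image_sub_le_of_norm_hasDerivWithin_le
      (f := G) (C := ‖P‖ + ‖c‖ + 1) (fun r _ => (hGder r).hasDerivWithinAt) (fun r _ => ?_)
      (Set.mem_univ s) (Set.mem_univ t)
    · exact this
    · have h1 := (Complex.abs_re_le_norm (P (r : UnitAddCircle))).trans
        (P.norm_coe_le_norm (r : UnitAddCircle))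
      have h2 := Complex.abs_re_le_norm c
      rw [Real.norm_eq_abs]
      refine (abs_sub _ _).trans ?_
      linarith
  refine ⟨fun x => (g x).re, fun x => (v x).re, hmemg, ?_, hvc, hgcob⟩
  have hvar := evar_le hH hΦ1
  have hvar' : (eVariationOn (fun t : ℝ => f (t : UnitAddCircle) - (g (t : UnitAddCircle)).re)
      (Set.Icc 0 1)).toReal ≤ 2 * ε' :=
    ENNReal.toReal_le_of_le_ofReal (by positivity) hvar
  have hmonoΦ : ∀ s t, 0 ≤ s → s ≤ t → t ≤ 1 → Φ s ≤ Φ t := fun s t h0 h1 h2 =>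
    sub_nonneg.1 ((abs_nonneg _).trans (hH s t h0 h1 h2))
  set h : UnitAddCircle → ℝ := fun z => f z - (g z).re with hh
  have hhc : Continuous h := hfc.sub hgc
  have hh0 : ∫ z, h z = 0 := by
    simp only [hh]
    rw [integral_sub (hint hfc) (hint hgc), hfi, hg0, sub_self]
  have hosc : ∀ x y : UnitAddCircle, |h x - h y| ≤ 2 * ε' := by
    have rep : ∀ x : UnitAddCircle, ∃ t : ℝ, 0 ≤ t ∧ t ≤ 1 ∧ (t : UnitAddCircle) = x := by
      intro x
      have := (AddCircle.equivIco 1 0 x).2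
      refine ⟨AddCircle.equivIco 1 0 x, this.1, ?_, AddCircle.coe_equivIco⟩
      exact this.2.le.trans_eq (zero_add 1)
    intro x y
    obtain ⟨t, ht0, ht1, rfl⟩ := rep x
    obtain ⟨s, hs0, hs1, rfl⟩ := rep y
    rcases le_total s t with hst | hst
    · have h1 := hH s t hs0 hst ht1
      have h2 := hmonoΦ 0 s le_rfl hs0 hs1
      have h3 := hmonoΦ t 1 ht0 ht1 le_rfl
      refine h1.trans ?_
      linarith
    · have h1 := hH t s ht0 hst hs1
      have h2 := hmonoΦ 0 t le_rfl ht0 ht1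
      have h3 := hmonoΦ s 1 hs0 hs1 le_rfl
      rw [abs_sub_comm]
      refine h1.trans ?_
      linarith
  have hsup : ∀ x, |h x| ≤ 2 * ε' := by
    intro x
    have e : h x = ∫ y, (h x - h y) := by
      rw [integral_sub (integrable_const _) (hint hhc), hh0]
      simp [real_univ]
    rw [e]
    have := norm_integral_le_of_norm_le_const (μ := (volume : Measure UnitAddCircle))
      (f := fun y => h x - h y) (C := 2 * ε') (.of_forall fun y => hosc x y)
    simpa [real_univ] using this
  have hsup' : (⨆ x, |h x|) ≤ 2 * ε' := ciSup_le hsup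
  unfold bvNorm
  calc _ ≤ 2 * ε' + 2 * ε' := add_le_add hsup' hvar'
    _ < ε := by rw [hε']; linarith

end Density

section Assembly

theorem cob_small {f v : UnitAddCircle → ℝ} {a : UnitAddCircle} (hv : Continuous v)
    (hf : ∀ x, f x = v (x + a) - v x) {ε : ℝ} (hε : 0 < ε) :
    ∃ n, ∀ x, BB (pOf f) a n x 0 ≤ ε := by
  obtain ⟨V, hV⟩ := isCompact_univ.exists_bound_of_continuousOn hv.continuousOn
  have hV' : ∀ x, |v x| ≤ V := fun x => hV x (Set.mem_univ x)
  have hF : ∀ x, |f x| ≤ 2 * V := by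
    intro x
    rw [hf x]
    have := abs_sub (v (x + a)) (v x)
    have h1 := hV' (x + a)
    have h2 := hV' x
    linarith
  set δ := Real.exp (-(2 * V)) / (1 + Real.exp (2 * V)) with hδ
  have hδ0 : 0 < δ := by positivity
  have hp1 : ∀ x, δ ≤ pOf f x := fun x => pOf_lower (hF x)
  have hp2 : ∀ x, δ ≤ 1 - pOf f x := by
    intro x
    rw [one_sub_pOf]
    refine pOf_lower (f := fun z => -f z) ?_
    rw [abs_neg]
    exact hF x
  have hbal : ∀ x, pOf f x * Real.exp (-v (x + a)) = (1 - pOf f x) * Real.exp (-v x) := by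
    intro x
    have h0 : (1 + Real.exp (f x)) ≠ 0 := by positivity
    have h1 : Real.exp (f x) * Real.exp (-v (x + a)) = Real.exp (-v x) := by
      rw [← Real.exp_add, hf x]
      congr 1
      ring
    unfold pOf
    rw [← h1]
    field_simp
    ring
  refine BB_small (δ := δ * δ) (fun x => pOf_mem f x) (by positivity) (fun x => ?_) ?_ hε
  · exact mul_le_mul (hp1 x) (hp2 _) hδ0.le (hδ0.le.trans (hp1 x))
  · intro ε' hε'
    exact BB_avg (fun x => pOf_mem f x) hV' hbal hp2 hδ0 ε' hε'

theorem abs_le_bvNorm {h : UnitAddCircle → ℝ} (hh : Continuous h) (x : UnitAddCircle) :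
    |h x| ≤ bvNorm h := by
  have hb : BddAbove (Set.range fun x => |h x|) := by
    have := (isCompact_univ.image (continuous_abs.comp hh)).bddAbove
    rw [Set.image_univ] at this
    exact this
  have h1 := le_ciSup hb x
  have h2 : 0 ≤ (eVariationOn (fun t : ℝ => h (t : UnitAddCircle)) (Set.Icc 0 1)).toReal :=
    ENNReal.toReal_nonneg
  unfold bvNorm
  linarith

def UU (α : ℝ) (m : ℕ) : Set (UnitAddCircle → ℝ) :=
  {f | ∃ n : ℕ, ∃ η : ℝ, η < 1 / ((m : ℝ) + 1) ∧
    (∀ x, BB (pOf f) (α : UnitAddCircle) n x 0 ≤ η) ∧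
    (∀ x, BB (pOf fun z => -f z) (((-α : ℝ)) : UnitAddCircle) n x 0 ≤ η)}

theorem UU_open {α : ℝ} {m : ℕ} {f : UnitAddCircle → ℝ} (hf : f ∈ UU α m) (hfP : memP f) :
    ∃ ε > 0, ∀ g, memP g → bvNorm (fun z => f z - g z) < ε → g ∈ UU α m := by
  obtain ⟨n, η, hη, h1, h2⟩ := hf
  set θ := (1 / ((m : ℝ) + 1) - η) / 2 with hθ
  have hθ0 : 0 < θ := by
    have : 0 < 1 / ((m : ℝ) + 1) - η := sub_pos.2 hη
    positivity
  refine ⟨θ / (n + 1), by positivity, ?_⟩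
  intro g hg hd
  have hsup : ∀ x, |f x - g x| ≤ θ / (n + 1) := fun x =>
    (abs_le_bvNorm (h := fun z => f z - g z) (hfP.1.sub hg.1) x).trans hd.le
  have hn : (n : ℝ) * (θ / (n + 1)) ≤ θ := by
    rw [mul_div_assoc', div_le_iff₀ (by positivity)]
    nlinarith
  refine ⟨n, η + θ, by rw [hθ]; linarith, fun x => ?_, fun x => ?_⟩
  · have := BB_close (a := (α : UnitAddCircle)) (pOf_mem f) (pOf_mem g)
      (fun x => (pOf_lip f g x).trans (hsup x)) n x 0
    have h3 := (abs_le.1 this).1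
    have h4 := h1 x
    linarith
  · have := BB_close (a := ((-α : ℝ) : UnitAddCircle)) (pOf_mem fun z => -f z)
      (pOf_mem fun z => -g z)
      (fun x => (pOf_lip (fun z => -f z) (fun z => -g z) x).trans
        (show |(-f x) - (-g x)| ≤ θ / (n + 1) by
          rw [neg_sub_neg, abs_sub_comm]; exact hsup x)) n x 0
    have h3 := (abs_le.1 this).1
    have h4 := h2 x
    linarith

theorem UU_dense {α : ℝ} (hα : Irrational α) (m : ℕ) {f : UnitAddCircle → ℝ} (hf : memP f)
    {ε : ℝ} (hε : 0 < ε) :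
    ∃ g ∈ UU α m, memP g ∧ bvNorm (fun z => f z - g z) < ε := by
  obtain ⟨g, v, hg, hd, hv, hcob⟩ := dense_cob hα hf hε
  refine ⟨g, ?_, hg, hd⟩
  have hη : 0 < 1 / ((m : ℝ) + 1) / 2 := by positivity
  obtain ⟨n₁, h1⟩ := cob_small hv hcob hη
  obtain ⟨n₂, h2⟩ := cob_small (f := fun z => -g z)
    (v := fun y => v (y + (α : UnitAddCircle))) (a := ((-α : ℝ) : UnitAddCircle))
    (hv.comp (continuous_add_const _)) (fun x => by
      have hx : x + ((-α : ℝ) : UnitAddCircle) + (α : UnitAddCircle) = x := by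
        rw [AddCircle.coe_neg]; abel
      simp only [hx, hcob x]
      ring) hη
  refine ⟨n₁ + n₂, _, half_lt_self (by positivity), fun x => ?_, fun x => ?_⟩
  · exact BB_mono_sup (pOf_mem g) h1 n₂ x 0
  · rw [add_comm]
    exact BB_mono_sup (pOf_mem fun z => -g z) h2 n₁ x 0

theorem tends_zero {u : ℕ → ℝ} (h0 : ∀ n, 0 ≤ u n)
    (h : ∀ m : ℕ, ∃ N, ∀ n, N ≤ n → u n < 1 / ((m : ℝ) + 1)) : Tendsto u atTop (nhds 0) := by
  rw [Metric.tendsto_atTop]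
  intro ε hε
  obtain ⟨m, hm⟩ := exists_nat_one_div_lt hε
  obtain ⟨N, hN⟩ := h m
  refine ⟨N, fun n hn => ?_⟩
  rw [Real.dist_eq, sub_zero, abs_of_nonneg (h0 n)]
  exact (hN n hn).trans hm

theorem UU_maxmin {α : ℝ} {f : UnitAddCircle → ℝ} (hf : ∀ m, f ∈ UU α m)
    {x : UnitAddCircle} {Ω : Type} [MeasurableSpace Ω] {ℙ : Measure Ω} {ξ : ℕ → Ω → ℤ}
    (hw : IsQPWalk (pOf f) α x 0 ℙ ξ) : MaxMinCond ℙ ξ := by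
  refine ⟨tends_zero (fun _ => ENNReal.toReal_nonneg) fun m => ?_,
    tends_zero (fun _ => ENNReal.toReal_nonneg) fun m => ?_⟩
  · obtain ⟨N, η, hη, h1, -⟩ := hf m
    refine ⟨N, fun n hn => ?_⟩
    obtain ⟨k, rfl⟩ := Nat.exists_eq_add_of_le hn
    exact ((prob_max_le hw (pOf_mem f) (N + k)).trans
      (BB_mono_sup (pOf_mem f) h1 k x 0)).trans_lt hη
  · obtain ⟨N, η, hη, -, h2⟩ := hf m
    refine ⟨N, fun n hn => ?_⟩
    obtain ⟨k, rfl⟩ := Nat.exists_eq_add_of_le hn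
    have hw' := walk_neg hw
    have e : (fun z => 1 - pOf f z) = pOf fun z => -f z := funext fun z => one_sub_pOf f z
    rw [e] at hw'
    have h3 := prob_max_le hw' (pOf_mem fun z => -f z) (N + k)
    simp only [neg_le_neg_iff] at h3
    exact (h3.trans (BB_mono_sup (pOf_mem fun z => -f z) h2 k x 0)).trans_lt hη

end Assembly

/-- Proposition 3: for every irrational `α` there is a dense `G_δ`
subset `R(α)` of `𝒫` such that condition (1.6) holds for every triple `(𝔭, α, x)`
with `𝔣 ∈ R(α)`, `x ∈ 𝕋`, where `𝔭 = e^𝔣/(1+e^𝔣)`. -/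
theorem statement4 (α : ℝ) (hα : Irrational α) :
    ∃ R : Set (UnitAddCircle → ℝ), R ⊆ {𝔣 | memP 𝔣} ∧
      (∃ U : ℕ → Set (UnitAddCircle → ℝ),
        (∀ n, ∀ f ∈ U n, memP f →
          ∃ ε > 0, ∀ g, memP g → bvNorm (fun z => f z - g z) < ε → g ∈ U n) ∧
        (∀ n, ∀ f, memP f → ∀ ε > 0,
          ∃ g ∈ U n, memP g ∧ bvNorm (fun z => f z - g z) < ε) ∧
        R = {𝔣 | memP 𝔣} ∩ ⋂ n, U n) ∧
      ∀ 𝔣 ∈ R, ∀ (x : UnitAddCircle) (Ω : Type) [MeasurableSpace Ω] (ℙ : Measure Ω)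
        (ξ : ℕ → Ω → ℤ), IsQPWalk (pOf 𝔣) α x 0 ℙ ξ → MaxMinCond ℙ ξ := by
  refine ⟨{f | memP f} ∩ ⋂ n, UU α n, Set.inter_subset_left, ⟨UU α, fun n f hf hP => UU_open hf hP,
    fun n f hf ε hε => UU_dense hα n hf hε, rfl⟩, ?_⟩
  intro f hf x Ω _ ℙ ξ hw
  exact UU_maxmin (fun m => Set.mem_iInter.1 hf.2 m) hw
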